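/- Let t be a bounded t-structure transversal to a bounded weight structure w on a triangulated category C, and let W_{≤m} denote the weight filtration functors on the heart Ht (so that for each X ∈ C^{t=0}, W_{≤m}X is the unique functorial increasing filtration of X with m-th graded factor in A_m = C^{t=0} ∩ C_{w=m}). Then for any Y ∈ Obj C and m ∈ ℤ: Y ∈ C_{w≤m} if and only if W_{≤m+j}(H^t_j(Y)) = H^t_j(Y) for every j ∈ ℤ, and Y ∈ C_{w≥m} if and only if W_{≤m+j−1}(H^t_j(Y)) = 0 for every j ∈ ℤ. -/

import Mathlib

namespace PaperWeights

open CategoryTheory CategoryTheory.Limits CategoryTheory.Pretriangulated CategoryTheory.Triangulated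

universe v u

variable (C : Type u) [Category.{v} C] [HasZeroObject C] [Preadditive C] [HasShift C ℤ]
  [∀ n : ℤ, (shiftFunctor C n).Additive] [Pretriangulated C]

/-- A class of objects of a triangulated category is *extension-stable* if for every
distinguished triangle `A ⟶ B ⟶ C`, `A ∈ D` and `C ∈ D` imply `B ∈ D`. -/
def ExtensionStable (D : Set C) : Prop :=
  ∀ T : Triangle C, (T ∈ distTriang C) → T.obj₁ ∈ D → T.obj₃ ∈ D → T.obj₂ ∈ D

/-- The pair of classes `(le, ge)`, playing the roles of `C_{w≤0}` and `C_{w≥0}`,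
defines a weight structure on the triangulated category `C`. -/
structure IsWeightStructure (le ge : Set C) : Prop where
  retract_le : ∀ ⦃X Y : C⦄ (s : X ⟶ Y) (r : Y ⟶ X), s ≫ r = 𝟙 X → Y ∈ le → X ∈ le
  retract_ge : ∀ ⦃X Y : C⦄ (s : X ⟶ Y) (r : Y ⟶ X), s ≫ r = 𝟙 X → Y ∈ ge → X ∈ ge
  zero_le : ∀ ⦃X : C⦄, IsZero X → X ∈ le
  zero_ge : ∀ ⦃X : C⦄, IsZero X → X ∈ ge
  sum_le : ∀ ⦃X Y : C⦄ (b : BinaryBicone X Y), b.IsBilimit → X ∈ le → Y ∈ le → b.pt ∈ le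
  sum_ge : ∀ ⦃X Y : C⦄ (b : BinaryBicone X Y), b.IsBilimit → X ∈ ge → Y ∈ ge → b.pt ∈ ge
  shift_le : ∀ ⦃X : C⦄, X ∈ le → (X⟦(-1 : ℤ)⟧) ∈ le
  shift_ge : ∀ ⦃X : C⦄, X ∈ ge → (X⟦(1 : ℤ)⟧) ∈ ge
  orthogonal : ∀ ⦃X Y : C⦄, X ∈ le → Y ∈ ge → ∀ f : X ⟶ (Y⟦(1 : ℤ)⟧), f = 0
  exists_decomp : ∀ M : C, ∃ (B A : C) (f : B ⟶ M) (g : M ⟶ A) (h : A ⟶ B⟦(1 : ℤ)⟧),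
    B ∈ le ∧ (A⟦(-1 : ℤ)⟧) ∈ ge ∧ (Triangle.mk f g h ∈ distTriang C)

/-- The shift `P[i]` of a class of objects: `X ∈ P[i]` iff `X⟦-i⟧ ∈ P`.
For a weight structure this gives `C_{w≤i} = C_{w≤0}[i]` and `C_{w≥i} = C_{w≥0}[i]`. -/
def shiftedClass (P : Set C) (i : ℤ) : Set C := fun X => (X⟦(-i)⟧) ∈ P

/-- `C_{w=i} = C_{w≤i} ∩ C_{w≥i}`. -/
def wEq (le ge : Set C) (i : ℤ) : Set C := shiftedClass C le i ∩ shiftedClass C ge i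

/-- Boundedness of a weight structure. -/
def WBounded (le ge : Set C) : Prop :=
  ∀ X : C, (∃ i : ℤ, X ∈ shiftedClass C le i) ∧ (∃ i : ℤ, X ∈ shiftedClass C ge i)

/-- The class `C^{t=0}` of a `t`-structure. -/
def heartSet (t : TStructure C) : Set C := fun X => t.le 0 X ∧ t.ge 0 X

/-- The heart of a `t`-structure, as a full subcategory. -/
abbrev THeart (t : TStructure C) := ObjectProperty.FullSubcategory (fun X : C => X ∈ heartSet C t)

/-- The inclusion of the heart. -/
abbrev heartIncl (t : TStructure C) : THeart C t ⥤ C :=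
  ObjectProperty.ι (fun X : C => X ∈ heartSet C t)

/-- Boundedness of a `t`-structure. -/
def TBounded (t : TStructure C) : Prop :=
  ∀ X : C, (∃ n : ℤ, t.le n X) ∧ (∃ n : ℤ, t.ge n X)

/-- A *nice decomposition* of `X ∈ C^{t=0}` for `m ∈ ℤ`: a distinguished triangle
`w_{≤m}X ⟶ X ⟶ w_{≥m+1}X ⟶ (w_{≤m}X)[1]` with `w_{≤m}X ∈ C_{w≤m} ∩ C^{t=0}` and
`w_{≥m+1}X ∈ C_{w≥m+1} ∩ C^{t=0}`. -/
def NiceDecomp (le ge : Set C) (t : TStructure C) (m : ℤ) (X : C) : Prop :=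
  ∃ (W B : C) (f : W ⟶ X) (g : X ⟶ B) (h : B ⟶ W⟦(1 : ℤ)⟧),
    (Triangle.mk f g h ∈ distTriang C) ∧
    W ∈ shiftedClass C le m ∧ B ∈ shiftedClass C ge (m + 1) ∧
    W ∈ heartSet C t ∧ B ∈ heartSet C t

/-- `t` and `w` are transversal: every object of the heart admits a nice
decomposition for every `m`. -/
def Transversal (le ge : Set C) (t : TStructure C) : Prop :=
  ∀ X ∈ heartSet C t, ∀ m : ℤ, NiceDecomp C le ge t m X

/-- Truncation data for a t-structure `t`: functors `τ_{≤0}`, `τ_{≥0}` with the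
usual universal properties (such data always exists for a t-structure), together
with the zeroth homology functor data and the canonical identification of
`H^t_0` with the identity on the heart. -/
structure TruncData (t : TStructure C) where
  truncLE : C ⥤ C
  truncGE : C ⥤ C
  /-- the canonical map `τ_{≤0}X ⟶ X` -/
  εLE : truncLE ⟶ 𝟭 C
  /-- the canonical map `X ⟶ τ_{≥0}X` -/
  ηGE : 𝟭 C ⟶ truncGE
  mem_le : ∀ X : C, t.le 0 (truncLE.obj X)
  mem_ge : ∀ X : C, t.ge 0 (truncGE.obj X)
  le_univ : ∀ (W X : C), t.le 0 W →
    Function.Bijective (fun f : W ⟶ truncLE.obj X => f ≫ εLE.app X)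
  ge_univ : ∀ (X W : C), t.ge 0 W →
    Function.Bijective (fun f : truncGE.obj X ⟶ W => ηGE.app X ≫ f)
  mem_heart : ∀ X : C, truncGE.obj (truncLE.obj X) ∈ heartSet C t
  /-- the canonical identification `H^t_0(X) ≅ X` for `X` in the heart -/
  isoHeart : ∀ X : C, X ∈ heartSet C t → (truncGE.obj (truncLE.obj X) ≅ X)

variable {C}

/-- The zeroth homology functor `H^t_0 : C ⥤ Ht` associated to truncation data. -/
def TruncData.H₀ {t : TStructure C} (τ : TruncData C t) : C ⥤ THeart C t :=
  ObjectProperty.lift _ (τ.truncLE ⋙ τ.truncGE) (fun X => τ.mem_heart X)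

/-- The homology functors `H^t_i(X) = H^t_0(X⟦i⟧)`. -/
def TruncData.H {t : TStructure C} (τ : TruncData C t) (i : ℤ) : C ⥤ THeart C t :=
  shiftFunctor C i ⋙ τ.H₀

/-- The identification `H^t_0(X) ≅ X` for `X` in the heart, as an isomorphism
in the heart. -/
def TruncData.heartIso {t : TStructure C} (τ : TruncData C t) (X : THeart C t) :
    τ.H₀.obj X.obj ≅ X where
  hom := ObjectProperty.homMk (τ.isoHeart X.obj X.property).hom
  inv := ObjectProperty.homMk (τ.isoHeart X.obj X.property).inv
  hom_inv_id := ObjectProperty.hom_ext _ (τ.isoHeart X.obj X.property).hom_inv_id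
  inv_hom_id := ObjectProperty.hom_ext _ (τ.isoHeart X.obj X.property).inv_hom_id


section Aux


section Tri

variable {X Y Z : C} {f : X ⟶ Y} {g : Y ⟶ Z} {h : Z ⟶ X⟦(1 : ℤ)⟧}

lemma coy2 (hT : Triangle.mk f g h ∈ distTriang C) {S : C} (x : S ⟶ Y) (hx : x ≫ g = 0) :
    ∃ y : S ⟶ X, x = y ≫ f := Triangle.coyoneda_exact₂ _ hT x hx

lemma coy3 (hT : Triangle.mk f g h ∈ distTriang C) {S : C} (x : S ⟶ Z) (hx : x ≫ h = 0) :
    ∃ y : S ⟶ Y, x = y ≫ g := Triangle.coyoneda_exact₃ _ hT x hx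

lemma coy1 (hT : Triangle.mk f g h ∈ distTriang C) {S : C} (x : S ⟶ X⟦(1 : ℤ)⟧)
    (hx : x ≫ f⟦(1 : ℤ)⟧' = 0) :
    ∃ y : S ⟶ Z, x = y ≫ h := Triangle.coyoneda_exact₁ _ hT x hx

lemma coy0 (hT : Triangle.mk f g h ∈ distTriang C) {S : C} (x : S ⟶ X)
    (hx : x ≫ f = 0) :
    ∃ (y : S ⟶ Z⟦(-1 : ℤ)⟧) (k : Z⟦(-1 : ℤ)⟧ ⟶ X), x = y ≫ k := by
  obtain ⟨y, hy⟩ := Triangle.coyoneda_exact₂ _ (inv_rot_of_distTriang _ hT) x hx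
  exact ⟨y, _, hy⟩

lemma yon2 (hT : Triangle.mk f g h ∈ distTriang C) {S : C} (x : Y ⟶ S) (hx : f ≫ x = 0) :
    ∃ y : Z ⟶ S, x = g ≫ y := Triangle.yoneda_exact₂ _ hT x hx

lemma yon3 (hT : Triangle.mk f g h ∈ distTriang C) {S : C} (x : Z ⟶ S) (hx : g ≫ x = 0) :
    ∃ y : X⟦(1 : ℤ)⟧ ⟶ S, x = h ≫ y := Triangle.yoneda_exact₃ _ hT x hx

lemma tri_morphism {X' Y' Z' : C} {f' : X' ⟶ Y'} {g' : Y' ⟶ Z'} {h' : Z' ⟶ X'⟦(1 : ℤ)⟧}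
    (hT : Triangle.mk f g h ∈ distTriang C) (hT' : Triangle.mk f' g' h' ∈ distTriang C)
    (a : X ⟶ X') (b : Y ⟶ Y') (hab : f ≫ b = a ≫ f') :
    ∃ c : Z ⟶ Z', g ≫ c = b ≫ g' ∧ h ≫ a⟦(1 : ℤ)⟧' = c ≫ h' :=
  complete_distinguished_triangle_morphism _ _ hT hT' a b hab

end Tri

section Weight

variable {le ge : Set C}

/-- Closure under isomorphisms, as a plain implication. -/
def IsoClosed (P : Set C) : Prop := ∀ ⦃X Y : C⦄, (X ≅ Y) → X ∈ P → Y ∈ P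

lemma IsWeightStructure.iso_le (hw : IsWeightStructure C le ge) : IsoClosed le :=
  fun _ _ e h => hw.retract_le e.inv e.hom e.inv_hom_id h

lemma IsWeightStructure.iso_ge (hw : IsWeightStructure C le ge) : IsoClosed ge :=
  fun _ _ e h => hw.retract_ge e.inv e.hom e.inv_hom_id h

lemma IsoClosed.shifted {P : Set C} (hP : IsoClosed P) (n : ℤ) :
    IsoClosed (shiftedClass C P n) :=
  fun _ _ e h => hP ((shiftFunctor C (-n)).mapIso e) h

lemma shifted_shift_iff {P : Set C} (hP : IsoClosed P) (X : C) (a n n' : ℤ) (h : n' + a = n) :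
    X⟦a⟧ ∈ shiftedClass C P n ↔ X ∈ shiftedClass C P n' := by
  have e : X⟦a⟧⟦-n⟧ ≅ X⟦-n'⟧ := ((shiftFunctorAdd' C a (-n) (-n') (by lia)).app X).symm
  exact ⟨fun h => hP e h, fun h => hP e.symm h⟩

lemma IsWeightStructure.ge_succ (hw : IsWeightStructure C le ge) {X : C} {n : ℤ}
    (h : X ∈ shiftedClass C ge (n + 1)) : X ∈ shiftedClass C ge n := by
  have h2 := hw.shift_ge h
  exact hw.iso_ge ((shiftFunctorAdd' C (-(n+1)) 1 (-n) (by lia)).app X).symm h2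

lemma IsWeightStructure.le_succ (hw : IsWeightStructure C le ge) {X : C} {n : ℤ}
    (h : X ∈ shiftedClass C le n) : X ∈ shiftedClass C le (n + 1) := by
  have h2 := hw.shift_le h
  exact hw.iso_le ((shiftFunctorAdd' C (-n) (-1) (-(n+1)) (by lia)).app X).symm h2

lemma IsWeightStructure.ge_anti (hw : IsWeightStructure C le ge) {X : C} {m n : ℤ} (hmn : m ≤ n)
    (h : X ∈ shiftedClass C ge n) : X ∈ shiftedClass C ge m := by
  obtain ⟨k, rfl⟩ := Int.le.dest hmn
  induction k with
  | zero => simpa using h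
  | succ k ih =>
    refine ih (by lia) (hw.ge_succ ?_)
    convert h using 2
    push_cast; ring

lemma IsWeightStructure.le_mono (hw : IsWeightStructure C le ge) {X : C} {m n : ℤ} (hmn : m ≤ n)
    (h : X ∈ shiftedClass C le m) : X ∈ shiftedClass C le n := by
  obtain ⟨k, rfl⟩ := Int.le.dest hmn
  induction k with
  | zero => simpa using h
  | succ k ih =>
    have := hw.le_succ (ih (by lia))
    convert this using 2
    push_cast; ring

lemma IsWeightStructure.orth (hw : IsWeightStructure C le ge) {X Y : C} {m n : ℤ} (hmn : m < n)
    (hX : X ∈ shiftedClass C le m) (hY : Y ∈ shiftedClass C ge n) (f : X ⟶ Y) : f = 0 := by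
  have hY' : Y ∈ shiftedClass C ge (m + 1) := hw.ge_anti (by lia) hY
  let e := (shiftFunctorAdd' C (-(m+1)) 1 (-m) (by lia)).app Y
  have h := hw.orthogonal hX hY' (f⟦-m⟧' ≫ e.hom)
  apply (shiftFunctor C (-m)).map_injective
  rw [Functor.map_zero, ← cancel_mono e.hom, h, zero_comp]

lemma IsWeightStructure.le_of_orth (hw : IsWeightStructure C le ge) {X : C} {m : ℤ}
    (h : ∀ Y, Y ∈ shiftedClass C ge (m + 1) → ∀ f : X ⟶ Y, f = 0) :
    X ∈ shiftedClass C le m := by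
  obtain ⟨B, A, f, g, d, hB, hA, hT⟩ := hw.exists_decomp (X⟦-m⟧)
  have hA' : A⟦m⟧ ∈ shiftedClass C ge (m + 1) :=
    (shifted_shift_iff hw.iso_ge A m (m+1) 1 (by lia)).2 hA
  have hg : g = 0 := by
    apply (shiftFunctor C m).map_injective
    have := h _ hA' ((shiftNegShift X m).inv ≫ g⟦m⟧')
    rw [Functor.map_zero, ← cancel_epi (shiftNegShift X m).inv, this, comp_zero]
  obtain ⟨s, hs⟩ := coy2 hT (𝟙 (X⟦-m⟧)) (by simp [hg])
  exact hw.retract_le s f hs.symm hB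

lemma IsWeightStructure.ge_of_orth (hw : IsWeightStructure C le ge) {X : C} {m : ℤ}
    (h : ∀ Y, Y ∈ shiftedClass C le (m - 1) → ∀ f : Y ⟶ X, f = 0) :
    X ∈ shiftedClass C ge m := by
  obtain ⟨B, A, f, g, d, hB, hA, hT⟩ := hw.exists_decomp (X⟦-m+1⟧)
  have hB0 : B ∈ shiftedClass C le 0 := by
    refine hw.iso_le ?_ hB
    exact ((shiftFunctorZero' C (-0) (by simp)).app B).symm
  have hB' : B⟦m-1⟧ ∈ shiftedClass C le (m - 1) :=
    (shifted_shift_iff hw.iso_le B (m-1) (m-1) 0 (by lia)).2 hB0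
  have hf : f = 0 := by
    apply (shiftFunctor C (m-1)).map_injective
    let e := (shiftFunctorAdd' C (-m+1) (m-1) 0 (by lia)).symm.app X ≪≫ (shiftFunctorZero C ℤ).app X
    have := h _ hB' (f⟦m-1⟧' ≫ e.hom)
    rw [Functor.map_zero, ← cancel_mono e.hom, this, zero_comp]
  obtain ⟨s, hs⟩ := yon2 hT (𝟙 (X⟦-m+1⟧)) (by simp [hf])
  have h1 : X⟦-m+1⟧⟦(-1 : ℤ)⟧ ∈ ge := by
    refine hw.retract_ge (g⟦(-1:ℤ)⟧') (s⟦(-1:ℤ)⟧') ?_ hA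
    have hs' : g ≫ s = 𝟙 _ := hs.symm
    rw [← Functor.map_comp, hs', CategoryTheory.Functor.map_id]
  exact hw.iso_ge ((shiftFunctorAdd' C (-m+1) (-1) (-m) (by lia)).app X).symm h1

lemma IsWeightStructure.le_ext (hw : IsWeightStructure C le ge) (m : ℤ) :
    ExtensionStable C (shiftedClass C le m) := by
  intro T hT h1 h3
  refine hw.le_of_orth fun Y hY f => ?_
  obtain ⟨g, rfl⟩ := Triangle.yoneda_exact₂ _ hT f (hw.orth (by lia) h1 hY _)
  rw [hw.orth (by lia) h3 hY g, comp_zero]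

lemma IsWeightStructure.ge_ext (hw : IsWeightStructure C le ge) (m : ℤ) :
    ExtensionStable C (shiftedClass C ge m) := by
  intro T hT h1 h3
  refine hw.ge_of_orth fun Y hY f => ?_
  obtain ⟨g, rfl⟩ := Triangle.coyoneda_exact₂ _ hT f (hw.orth (by lia) hY h3 _)
  rw [hw.orth (by lia) hY h1 g, zero_comp]

lemma IsWeightStructure.zero_le' (hw : IsWeightStructure C le ge) (m : ℤ) {X : C} (h : IsZero X) :
    X ∈ shiftedClass C le m := hw.zero_le ((shiftFunctor C (-m)).map_isZero h)

lemma IsWeightStructure.zero_ge' (hw : IsWeightStructure C le ge) (m : ℤ) {X : C} (h : IsZero X) :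
    X ∈ shiftedClass C ge m := hw.zero_ge ((shiftFunctor C (-m)).map_isZero h)

lemma IsWeightStructure.retract_le' (hw : IsWeightStructure C le ge) (m : ℤ) {X Y : C}
    (s : X ⟶ Y) (r : Y ⟶ X) (h : s ≫ r = 𝟙 X) (hY : Y ∈ shiftedClass C le m) :
    X ∈ shiftedClass C le m :=
  hw.retract_le (s⟦-m⟧') (r⟦-m⟧') (by rw [← Functor.map_comp, h, CategoryTheory.Functor.map_id]) hY

lemma IsWeightStructure.retract_ge' (hw : IsWeightStructure C le ge) (m : ℤ) {X Y : C}
    (s : X ⟶ Y) (r : Y ⟶ X) (h : s ≫ r = 𝟙 X) (hY : Y ∈ shiftedClass C ge m) :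
    X ∈ shiftedClass C ge m :=
  hw.retract_ge (s⟦-m⟧') (r⟦-m⟧') (by rw [← Functor.map_comp, h, CategoryTheory.Functor.map_id]) hY

end Weight

section Homology

variable (t : TStructure C)

lemma tzero {t : TStructure C} {X Y : C} (f : X ⟶ Y) {a b : ℤ} (h : a < b)
    (hX : t.le a X) (hY : t.ge b Y) : f = 0 :=
  t.zero_of_isLE_of_isGE f a b h ⟨hX⟩ ⟨hY⟩

/-- `u : U ⟶ V` has the universal property of `τ_{≤n} V ⟶ V`. -/
structure IsTrLE (n : ℤ) {U V : C} (u : U ⟶ V) : Prop where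
  mem : t.le n U
  surj : ∀ {T : C}, t.le n T → ∀ f : T ⟶ V, ∃ g : T ⟶ U, g ≫ u = f
  inj : ∀ {T : C}, t.le n T → ∀ g : T ⟶ U, g ≫ u = 0 → g = 0

/-- `p : V ⟶ D` has the universal property of `V ⟶ τ_{≥n} V`. -/
structure IsTrGE (n : ℤ) {V D : C} (p : V ⟶ D) : Prop where
  mem : t.ge n D
  surj : ∀ {N : C}, t.ge n N → ∀ f : V ⟶ N, ∃ g : D ⟶ N, p ≫ g = f
  inj : ∀ {N : C}, t.ge n N → ∀ g : D ⟶ N, p ≫ g = 0 → g = 0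

/-- `D` is a model of `τ_{≥n} τ_{≤n} V`. -/
def IsH (n : ℤ) (V D : C) : Prop :=
  ∃ (U : C) (u : U ⟶ V) (p : U ⟶ D), IsTrLE t n u ∧ IsTrGE t n p

variable {t}

lemma isTrLE_of_triangle {n : ℤ} {X V Z : C} {u : X ⟶ V} {g : V ⟶ Z} {d : Z ⟶ X⟦(1 : ℤ)⟧}
    (hT : Triangle.mk u g d ∈ distTriang C)
    (h1 : t.le n X) (h3 : t.ge (n + 1) Z) : IsTrLE t n u where
  mem := h1
  surj hS f := by
    obtain ⟨g, hg⟩ := coy2 hT f (tzero _ (by lia) hS h3)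
    exact ⟨g, hg.symm⟩
  inj {S} hS x hg := by
    obtain ⟨k, k', hk⟩ := coy0 hT x hg
    have : k = 0 := tzero (t := t) (b := n + 2) k (by lia) hS
      (t.ge_shift (n+1) (-1) (n+2) (by lia) _ h3)
    rw [hk, this]; exact zero_comp

lemma isTrGE_of_triangle {n : ℤ} {X V Z : C} {u : X ⟶ V} {g : V ⟶ Z} {d : Z ⟶ X⟦(1 : ℤ)⟧}
    (hT : Triangle.mk u g d ∈ distTriang C)
    (h1 : t.le (n - 1) X) (h3 : t.ge n Z) : IsTrGE t n g where
  mem := h3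
  surj hS f := by
    obtain ⟨g, hg⟩ := yon2 hT f (tzero _ (by lia) h1 hS)
    exact ⟨g, hg.symm⟩
  inj {S} hS x hg := by
    obtain ⟨k, hk⟩ := yon3 hT x hg
    have : k = 0 := tzero (t := t) (a := n - 2) k (by lia)
      (t.le_shift (n-1) 1 (n-2) (by lia) _ h1) hS
    rw [hk, this]; exact comp_zero

lemma IsTrLE.exists_iso {n : ℤ} {U U' V : C} {u : U ⟶ V} {u' : U' ⟶ V}
    (h : IsTrLE t n u) (h' : IsTrLE t n u') : ∃ e : U ≅ U', e.hom ≫ u' = u := by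
  obtain ⟨a, ha⟩ := h'.surj h.mem u
  obtain ⟨b, hb⟩ := h.surj h'.mem u'
  refine ⟨⟨a, b, ?_, ?_⟩, ha⟩
  · exact sub_eq_zero.1 (h.inj h.mem _ (by simp [ha, hb]))
  · exact sub_eq_zero.1 (h'.inj h'.mem _ (by simp [ha, hb]))

lemma IsTrGE.exists_iso {n : ℤ} {D D' V : C} {p : V ⟶ D} {p' : V ⟶ D'}
    (h : IsTrGE t n p) (h' : IsTrGE t n p') : ∃ e : D ≅ D', p ≫ e.hom = p' := by
  obtain ⟨a, ha⟩ := h.surj h'.mem p'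
  obtain ⟨b, hb⟩ := h'.surj h.mem p
  refine ⟨⟨a, b, ?_, ?_⟩, ha⟩
  · exact sub_eq_zero.1 (h.inj h.mem _ (by simp [reassoc_of% ha, hb]))
  · exact sub_eq_zero.1 (h'.inj h'.mem _ (by simp [reassoc_of% hb, ha]))

lemma IsTrGE.precomp_iso {n : ℤ} {D U U' : C} {p : U ⟶ D} (h : IsTrGE t n p) (e : U' ≅ U) :
    IsTrGE t n (e.hom ≫ p) where
  mem := h.mem
  surj hN f := by
    obtain ⟨g, hg⟩ := h.surj hN (e.inv ≫ f)
    exact ⟨g, by simp [hg]⟩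
  inj hN g hg := h.inj hN g (by rwa [Category.assoc, ← cancel_epi e.inv, e.inv_hom_id_assoc,
    comp_zero] at hg)

lemma IsTrLE.postcomp_iso {n : ℤ} {U V V' : C} {u : U ⟶ V} (h : IsTrLE t n u) (e : V ≅ V') :
    IsTrLE t n (u ≫ e.hom) where
  mem := h.mem
  surj hN f := by
    obtain ⟨g, hg⟩ := h.surj hN (f ≫ e.inv)
    exact ⟨g, by simp [reassoc_of% hg]⟩
  inj hN g hg := h.inj hN g (by rw [← cancel_mono e.hom]; simpa using hg)

lemma IsH.unique {n : ℤ} {V D D' : C} (h : IsH t n V D) (h' : IsH t n V D') :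
    Nonempty (D ≅ D') := by
  obtain ⟨U, u, p, hu, hp⟩ := h
  obtain ⟨U', u', p', hu', hp'⟩ := h'
  obtain ⟨e, -⟩ := hu.exists_iso hu'
  obtain ⟨e', -⟩ := hp.exists_iso (hp'.precomp_iso e)
  exact ⟨e'⟩

lemma IsH.of_iso {n : ℤ} {V V' D : C} (h : IsH t n V D) (e : V ≅ V') : IsH t n V' D := by
  obtain ⟨U, u, p, hu, hp⟩ := h
  exact ⟨U, _, p, hu.postcomp_iso e, hp⟩

lemma IsTrLE.exists_triangle {n : ℤ} {U V : C} {u : U ⟶ V} (h : IsTrLE t n u) :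
    ∃ (Z : C) (g : V ⟶ Z) (d : Z ⟶ U⟦(1:ℤ)⟧), Triangle.mk u g d ∈ distTriang C ∧
      t.ge (n + 1) Z := by
  obtain ⟨X, Y, hX, hY, f, g, d, hT⟩ := t.exists_triangle V n (n + 1) rfl
  obtain ⟨e, he⟩ := h.exists_iso (isTrLE_of_triangle hT hX hY)
  refine ⟨Y, g, d ≫ e.inv⟦1⟧', ?_, hY⟩
  refine isomorphic_distinguished _ hT _ ?_
  refine Triangle.isoMk _ _ e (Iso.refl _) (Iso.refl _) ?_ ?_ ?_
  · change u ≫ 𝟙 V = e.hom ≫ f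
    rw [Category.comp_id]; exact he.symm
  · change g ≫ 𝟙 Y = 𝟙 V ≫ g
    simp
  · change (d ≫ e.inv⟦(1:ℤ)⟧') ≫ e.hom⟦(1:ℤ)⟧' = 𝟙 Y ≫ d
    rw [Category.assoc, ← Functor.map_comp, e.inv_hom_id, CategoryTheory.Functor.map_id, Category.id_comp]
    exact Category.comp_id d

/-- changing `V` by an object in degrees `≥ n + 1` -/
lemma IsH.of_triangle_ge {n : ℤ} {D X V Z : C} {f : X ⟶ V} {g : V ⟶ Z} {d : Z ⟶ X⟦(1 : ℤ)⟧}
    (hT : Triangle.mk f g d ∈ distTriang C)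
    (h3 : t.ge (n + 1) Z) (h : IsH t n X D) : IsH t n V D := by
  obtain ⟨U, u, p, hu, hp⟩ := h
  refine ⟨U, u ≫ f, p, ⟨hu.mem, fun {S} hS f => ?_, fun {S} hS g hg => ?_⟩, hp⟩
  · obtain ⟨g, hg⟩ := coy2 hT f (tzero _ (by lia) hS h3)
    obtain ⟨k, rfl⟩ := hu.surj hS g
    exact ⟨k, by simp [hg]⟩
  · apply hu.inj hS
    obtain ⟨k, k', hk⟩ := coy0 hT (g ≫ u) (by simpa using hg)
    have : k = 0 := tzero (t := t) (b := n + 2) k (by lia) hS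
      (t.ge_shift (n+1) (-1) (n+2) (by lia) _ h3)
    rw [hk, this]; exact zero_comp

/-- changing `V` by an object in degrees `≤ n - 1` -/
lemma IsH.of_triangle_le {n : ℤ} {D K V V' : C} {a : K ⟶ V} {b : V ⟶ V'} {c : V' ⟶ K⟦(1:ℤ)⟧}
    (hT : Triangle.mk a b c ∈ distTriang C)
    (h1 : t.le (n - 1) K) (h : IsH t n V D) : IsH t n V' D := by
  obtain ⟨U, u, p, hu, hp⟩ := h
  have hKn : t.le n K := t.le_monotone (by lia) _ h1
  obtain ⟨α, hα⟩ := hu.surj hKn a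
  obtain ⟨U', β, γ, hT'⟩ := distinguished_cocone_triangle α
  obtain ⟨φ, hφ1, hφ2⟩ := tri_morphism hT' hT (𝟙 K) u
    (by simpa using hα)
  rw [CategoryTheory.Functor.map_id] at hφ2
  have hφ2 : γ = φ ≫ c := (Category.comp_id γ).symm.trans hφ2
  obtain ⟨Z, zg, zd, hZ, hZge⟩ := hu.exists_triangle
  have hK1 : t.le (n - 2) (K⟦(1:ℤ)⟧) := t.le_shift (n-1) 1 (n-2) (by lia) _ h1
  have hU' : t.le n U' := by
    refine (t.isLE₂ _ (rot_of_distTriang _ hT') n ⟨hu.mem⟩ ⟨?_⟩).le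
    exact t.le_monotone (by lia) _ hK1
  have hab : α ≫ β = 0 := comp_distTriang_mor_zero₁₂ _ hT'
  have hαp : α ≫ p = 0 := tzero _ (by lia) h1 hp.mem
  obtain ⟨p', hp'⟩ := yon2 hT' p hαp
  change p = β ≫ p' at hp'
  refine ⟨U', φ, p', ⟨hU', fun {S} hS f => ?_, fun {S} hS y hy => ?_⟩,
    ⟨hp.mem, fun {N} hN q => ?_, fun {N} hN r hr => ?_⟩⟩
  · have h0 : (f ≫ c ≫ α⟦(1:ℤ)⟧') ≫ u⟦(1:ℤ)⟧' = 0 := by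
      have : c ≫ a⟦(1:ℤ)⟧' = 0 := comp_distTriang_mor_zero₃₁ _ hT
      simp only [Category.assoc, ← Functor.map_comp, hα, this, comp_zero]
    have h00 : f ≫ c ≫ α⟦(1:ℤ)⟧' = 0 := by
      obtain ⟨x, hx⟩ := coy1 hZ _ h0
      have : x = 0 := tzero (t := t) x (by lia : n < n + 1) hS hZge
      rw [hx, this]; exact zero_comp
    obtain ⟨y, hy⟩ := coy1 hT' (f ≫ c) (by rw [Category.assoc]; exact h00)
    change f ≫ c = y ≫ γ at hy
    obtain ⟨z, hz⟩ := coy3 hT (f - y ≫ φ)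
      (by change (f - y ≫ φ) ≫ c = 0; rw [Preadditive.sub_comp, Category.assoc, ← hφ2, hy, sub_self])
    change f - y ≫ φ = z ≫ b at hz
    obtain ⟨z', rfl⟩ := hu.surj hS z
    refine ⟨y + z' ≫ β, ?_⟩
    rw [Preadditive.add_comp, Category.assoc, hφ1, ← Category.assoc, ← hz]
    abel
  · obtain ⟨z, hz⟩ := coy3 hT' y
      (by change y ≫ γ = 0; rw [hφ2, ← Category.assoc, hy, zero_comp])
    change y = z ≫ β at hz
    obtain ⟨k, hk⟩ := coy2 hT (z ≫ u)
      (by change (z ≫ u) ≫ b = 0; rw [Category.assoc, ← hφ1, ← Category.assoc, ← hz, hy])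
    change z ≫ u = k ≫ a at hk
    have : z - k ≫ α = 0 := hu.inj hS _ (by
      rw [Preadditive.sub_comp, Category.assoc, hα, hk, sub_self])
    rw [hz, sub_eq_zero.1 this, Category.assoc, hab, comp_zero]
  · obtain ⟨r, hr⟩ := hp.surj hN (β ≫ q)
    refine ⟨r, ?_⟩
    obtain ⟨s, hs⟩ := yon3 hT' (p' ≫ r - q)
      (by change β ≫ (p' ≫ r - q) = 0; rw [Preadditive.comp_sub, ← Category.assoc, ← hp', hr, sub_self])
    have : s = 0 := tzero (t := t) s (by lia : n - 2 < n) hK1 hN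
    rw [← sub_eq_zero, hs, this]; exact comp_zero
  · exact hp.inj hN r (by rw [hp', Category.assoc, hr, comp_zero])

lemma isTrLE_id {n : ℤ} {V : C} (h : t.le n V) : IsTrLE t n (𝟙 V) :=
  ⟨h, fun _ f => ⟨f, by simp⟩, fun _ g hg => by simpa using hg⟩

lemma isTrGE_id {n : ℤ} {V : C} (h : t.ge n V) : IsTrGE t n (𝟙 V) :=
  ⟨h, fun _ f => ⟨f, by simp⟩, fun _ g hg => by simpa using hg⟩

lemma isH_self {n : ℤ} {V : C} (h : t.le n V) (h' : t.ge n V) : IsH t n V V :=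
  ⟨V, 𝟙 V, 𝟙 V, isTrLE_id h, isTrGE_id h'⟩

lemma IsH.isZero_of_ge {n : ℤ} {V D : C} (h : IsH t n V D) (hV : t.ge (n + 1) V) : IsZero D := by
  obtain ⟨U, u, p, hu, hp⟩ := h
  have h1 : 𝟙 U = 0 := hu.inj hu.mem _ (tzero _ (by lia : n < n + 1) hu.mem hV)
  rw [IsZero.iff_id_eq_zero]
  apply hp.inj hp.mem
  rw [← Category.id_comp p, h1, zero_comp, zero_comp]

lemma IsH.isZero_of_le {n : ℤ} {V D : C} (h : IsH t n V D) (hV : t.le (n - 1) V) : IsZero D := by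
  obtain ⟨U, u, p, hu, hp⟩ := h
  obtain ⟨e, -⟩ := hu.exists_iso (isTrLE_id (t.le_monotone (by lia) _ hV))
  have hp0 : p = 0 := by
    rw [← cancel_epi e.inv, comp_zero]
    exact tzero _ (by lia : n - 1 < n) hV hp.mem
  rw [IsZero.iff_id_eq_zero]
  apply hp.inj hp.mem
  rw [hp0, zero_comp]

lemma IsH.shift {V D : C} (a n n' : ℤ) (hn : a + n' = n) (h : IsH t n V D) :
    IsH t n' (V⟦a⟧) (D⟦a⟧) := by
  obtain ⟨U, u, p, hu, hp⟩ := h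
  refine ⟨U⟦a⟧, u⟦a⟧', p⟦a⟧', ⟨t.le_shift n a n' hn _ hu.mem, fun {S} hS f => ?_,
    fun {S} hS g hg => ?_⟩, ⟨t.ge_shift n a n' hn _ hp.mem, fun {N} hN f => ?_,
    fun {N} hN g hg => ?_⟩⟩
  · let e := shiftNegShift S a
    obtain ⟨f', hf'⟩ := (shiftFunctor C a).map_surjective (e.hom ≫ f)
    obtain ⟨g, hg⟩ := hu.surj (t.le_shift n' (-a) n (by lia) _ hS) f'
    refine ⟨e.inv ≫ g⟦a⟧', ?_⟩
    rw [Category.assoc, ← Functor.map_comp, hg, hf', e.inv_hom_id_assoc]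
  · let e := shiftNegShift S a
    obtain ⟨g', hg'⟩ := (shiftFunctor C a).map_surjective (e.hom ≫ g)
    have : g' = 0 := hu.inj (t.le_shift n' (-a) n (by lia) _ hS) g' (by
      apply (shiftFunctor C a).map_injective
      rw [Functor.map_comp, hg', Category.assoc, hg, comp_zero, Functor.map_zero])
    rw [← cancel_epi e.hom, ← hg', this, Functor.map_zero, comp_zero]
  · let e := shiftNegShift N a
    obtain ⟨f', hf'⟩ := (shiftFunctor C a).map_surjective (f ≫ e.inv)
    obtain ⟨g, hg⟩ := hp.surj (t.ge_shift n' (-a) n (by lia) _ hN) f'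
    refine ⟨g⟦a⟧' ≫ e.hom, ?_⟩
    rw [← Category.assoc, ← Functor.map_comp, hg, hf', Category.assoc, e.inv_hom_id,
      Category.comp_id]
  · let e := shiftNegShift N a
    obtain ⟨g', hg'⟩ := (shiftFunctor C a).map_surjective (g ≫ e.inv)
    have : g' = 0 := hp.inj (t.ge_shift n' (-a) n (by lia) _ hN) g' (by
      apply (shiftFunctor C a).map_injective
      rw [Functor.map_comp, hg', ← Category.assoc, hg, zero_comp, Functor.map_zero])
    rw [← cancel_mono e.inv, ← hg', this, Functor.map_zero, zero_comp]

lemma TruncData.isH (τ : TruncData C t) (j : ℤ) (Y : C) :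
    IsH t j Y ((((τ.H j).obj Y).obj)⟦-j⟧) := by
  have h0 : IsH t 0 (Y⟦j⟧) ((τ.H j).obj Y).obj := by
    refine ⟨τ.truncLE.obj (Y⟦j⟧), τ.εLE.app _, τ.ηGE.app _,
      ⟨τ.mem_le _, fun {S} hS f => (τ.le_univ S _ hS).2 f, fun {S} hS g hg =>
        (τ.le_univ S _ hS).1 (by simpa using hg)⟩,
      ⟨τ.mem_ge _, fun {S} hS f => (τ.ge_univ _ S hS).2 f, fun {S} hS g hg =>
        (τ.ge_univ _ S hS).1 (hg.trans comp_zero.symm)⟩⟩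
  exact (h0.shift (-j) 0 j (by lia)).of_iso (shiftShiftNeg Y j)

end Homology

section Main

variable {le ge : Set C} {t : TStructure C}

lemma mem_of_homology {P : Set C} (hP : ExtensionStable C P) (hz : ∀ X : C, IsZero X → X ∈ P)
    (k : ℕ) : ∀ (Y : C) (b : ℤ), t.le b Y → t.ge (b - k + 1) Y →
      (∀ j D, IsH t j Y D → D ∈ P) → Y ∈ P := by
  induction k with
  | zero =>
    intro Y b h1 h2 _
    apply hz
    rw [IsZero.iff_id_eq_zero]
    exact tzero _ (by simp) h1 h2
  | succ k ih =>
    intro Y b h1 h2 h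
    obtain ⟨Y', Z, hY', hZ, f, g, d, hT⟩ := t.exists_triangle Y (b - 1) b (by lia)
    have hZP : Z ∈ P := h b Z ⟨Y, 𝟙 Y, g, isTrLE_id h1, isTrGE_of_triangle hT hY' hZ⟩
    have hY'P : Y' ∈ P := by
      refine ih Y' (b - 1) hY' ?_ ?_
      · refine (t.isGE₂ _ (inv_rot_of_distTriang _ hT) _ ⟨?_⟩ ⟨?_⟩).ge
        · exact t.ge_antitone (by lia) _ (t.ge_shift b (-1) (b+1) (by lia) _ hZ)
        · refine t.ge_antitone ?_ _ h2
          push_cast; lia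
      · intro j D hD
        by_cases hj : j ≤ b - 1
        · exact h j D (hD.of_triangle_ge hT (t.ge_antitone (by lia) _ hZ))
        · exact hz _ (hD.isZero_of_le (t.le_monotone (by lia) _ hY'))
    exact hP _ hT hY'P hZP

lemma top_weight (hw : IsWeightStructure C le ge) (htr : Transversal C le ge t)
    {m b : ℤ} {Y Z : C} {g : Y ⟶ Z} (hg : IsTrGE t b g) (hZ : t.le b Z)
    (hY : Y ∈ shiftedClass C le m) : Z ∈ shiftedClass C le m := by
  obtain ⟨W, B, f, q, d, hT, hW, hB, -, hBt⟩ := htr (Z⟦b⟧)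
    ⟨t.le_shift b b 0 (by lia) _ hZ, t.ge_shift b b 0 (by lia) _ hg.mem⟩ (m + b)
  have hB' : B⟦-b⟧ ∈ shiftedClass C ge (m + 1) :=
    (shifted_shift_iff hw.iso_ge B (-b) (m+1) (m+b+1) (by lia)).2 hB
  have hq : q = 0 := by
    apply (shiftFunctor C (-b)).map_injective
    have h0 := hg.inj (t.ge_shift 0 (-b) b (by lia) _ hBt.2) ((shiftShiftNeg Z b).inv ≫ q⟦-b⟧')
      (hw.orth (by lia) hY hB' _)
    rw [Functor.map_zero, ← cancel_epi (shiftShiftNeg Z b).inv, h0, comp_zero]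
  obtain ⟨s, hs⟩ := coy2 hT (𝟙 _) (by rw [hq, comp_zero])
  exact (shifted_shift_iff hw.iso_le Z b (m+b) m rfl).1 (hw.retract_le' _ s f hs.symm hW)

lemma bot_weight (hw : IsWeightStructure C le ge) (htr : Transversal C le ge t)
    {m a : ℤ} {X Y : C} {f : X ⟶ Y} (hf : IsTrLE t a f) (hX : t.ge a X)
    (hY : Y ∈ shiftedClass C ge m) : X ∈ shiftedClass C ge m := by
  obtain ⟨W, B, q, g, d, hT, hW, hB, hWt, -⟩ := htr (X⟦a⟧)
    ⟨t.le_shift a a 0 (by lia) _ hf.mem, t.ge_shift a a 0 (by lia) _ hX⟩ (m + a - 1)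
  have hW' : W⟦-a⟧ ∈ shiftedClass C le (m - 1) :=
    (shifted_shift_iff hw.iso_le W (-a) (m-1) (m+a-1) (by lia)).2 hW
  have hq : q = 0 := by
    apply (shiftFunctor C (-a)).map_injective
    have h0 := hf.inj (t.le_shift 0 (-a) a (by lia) _ hWt.1) (q⟦-a⟧' ≫ (shiftShiftNeg X a).hom)
      (hw.orth (by lia) hW' hY _)
    rw [Functor.map_zero, ← cancel_mono (shiftShiftNeg X a).hom, h0, zero_comp]
  obtain ⟨s, hs⟩ := yon2 hT (𝟙 _) (by rw [hq, zero_comp])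
  have hB' : B ∈ shiftedClass C ge (m + a) := by
    convert hB using 2; lia
  exact (shifted_shift_iff hw.iso_ge X a (m+a) m rfl).1 (hw.retract_ge' _ g s hs.symm hB')

lemma homology_le (hw : IsWeightStructure C le ge) (htr : Transversal C le ge t)
    (hex : ∀ j Y, ∃ D, IsH t j Y D) (m : ℤ)
    (k : ℕ) : ∀ (Y : C) (b : ℤ), t.le b Y → t.ge (b - k + 1) Y → Y ∈ shiftedClass C le m →
      (∀ j D, IsH t j Y D → D ∈ shiftedClass C le m) := by
  induction k with
  | zero =>
    intro Y b h1 h2 _ j D hD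
    apply hw.zero_le'
    by_cases hj : b ≤ j - 1
    · exact hD.isZero_of_le (t.le_monotone hj _ h1)
    · exact hD.isZero_of_ge (t.ge_antitone (by simp; lia) _ h2)
  | succ k ih =>
    intro Y b h1 h2 hY j D hD
    obtain ⟨Y', Z, hY', hZ, f, g, d, hT⟩ := t.exists_triangle Y (b - 1) b (by lia)
    have hg := isTrGE_of_triangle hT hY' hZ
    have hZb : t.le b Z := by
      refine (t.isLE₂ _ (rot_of_distTriang _ hT) _ ⟨h1⟩ ⟨?_⟩).le
      exact t.le_monotone (by lia) _ (t.le_shift (b-1) 1 (b-2) (by lia) _ hY')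
    have hZw := top_weight hw htr hg hZb hY
    have hY'w : Y' ∈ shiftedClass C le m := by
      refine hw.le_ext m _ (inv_rot_of_distTriang _ hT) ?_ hY
      exact hw.le_mono (by lia : m - 1 ≤ m)
        ((shifted_shift_iff hw.iso_le Z (-1) (m-1) m (by lia)).2 hZw)
    rcases lt_trichotomy j b with hj | rfl | hj
    · obtain ⟨D', hD'⟩ := hex j Y'
      obtain ⟨e⟩ := (hD'.of_triangle_ge hT (t.ge_antitone (by lia) _ hZ)).unique hD
      refine hw.iso_le.shifted m e (ih Y' (b - 1) hY' ?_ hY'w j D' hD')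
      refine (t.isGE₂ _ (inv_rot_of_distTriang _ hT) _ ⟨?_⟩ ⟨?_⟩).ge
      · exact t.ge_antitone (by lia) _ (t.ge_shift b (-1) (b+1) (by lia) _ hZ)
      · refine t.ge_antitone ?_ _ h2
        push_cast; lia
    · obtain ⟨e⟩ := IsH.unique ⟨Y, 𝟙 Y, g, isTrLE_id h1, hg⟩ hD
      exact hw.iso_le.shifted m e hZw
    · exact hw.zero_le' m (hD.isZero_of_le (t.le_monotone (by lia) _ h1))

lemma homology_ge (hw : IsWeightStructure C le ge) (htr : Transversal C le ge t) (m : ℤ)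
    (k : ℕ) : ∀ (Y : C) (a : ℤ), t.ge a Y → t.le (a + k - 1) Y → Y ∈ shiftedClass C ge m →
      (∀ j D, IsH t j Y D → D ∈ shiftedClass C ge m) := by
  induction k with
  | zero =>
    intro Y a h1 h2 _ j D hD
    apply hw.zero_ge'
    by_cases hj : a ≤ j
    · exact hD.isZero_of_le (t.le_monotone (by simp; lia) _ h2)
    · exact hD.isZero_of_ge (t.ge_antitone (by lia) _ h1)
  | succ k ih =>
    intro Y a h1 h2 hY j D hD
    obtain ⟨X, Y', hX, hY', f, g, d, hT⟩ := t.exists_triangle Y a (a + 1) (by lia)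
    have hf := isTrLE_of_triangle hT hX hY'
    have hXa : t.ge a X := by
      refine (t.isGE₂ _ (inv_rot_of_distTriang _ hT) _ ⟨?_⟩ ⟨h1⟩).ge
      exact t.ge_antitone (by lia) _ (t.ge_shift (a+1) (-1) (a+2) (by lia) _ hY')
    have hXw := bot_weight hw htr hf hXa hY
    have hY'w : Y' ∈ shiftedClass C ge m := by
      refine hw.ge_ext m _ (rot_of_distTriang _ hT) hY ?_
      exact hw.ge_anti (by lia : m ≤ m + 1)
        ((shifted_shift_iff hw.iso_ge X 1 (m+1) m (by lia)).2 hXw)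
    rcases lt_trichotomy j a with hj | rfl | hj
    · exact hw.zero_ge' m (hD.isZero_of_ge (t.ge_antitone (by lia) _ h1))
    · obtain ⟨e⟩ := IsH.unique ⟨X, f, 𝟙 X, hf, isTrGE_id hXa⟩ hD
      exact hw.iso_ge.shifted m e hXw
    · refine ih Y' (a + 1) hY' ?_ hY'w j D
        (hD.of_triangle_le hT (t.le_monotone (by lia) _ hX))
      refine (t.isLE₂ _ (rot_of_distTriang _ hT) _ ⟨?_⟩ ⟨?_⟩).le
      · refine t.le_monotone ?_ _ h2
        push_cast; lia
      · exact t.le_monotone (by lia) _ (t.le_shift a 1 (a-1) (by lia) _ hX)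

lemma exists_bounds (hbt : TBounded C t) (Y : C) :
    ∃ (a b : ℤ) (k : ℕ), t.ge a Y ∧ t.le b Y ∧ a = b - k + 1 := by
  obtain ⟨⟨b, hb⟩, ⟨a, ha⟩⟩ := hbt Y
  refine ⟨min a b, b, (b - min a b + 1).toNat, t.ge_antitone (min_le_left _ _) _ ha, hb, ?_⟩
  rw [Int.toNat_of_nonneg (by have := min_le_right a b; lia)]
  lia

lemma le_iff_homology (hw : IsWeightStructure C le ge) (htr : Transversal C le ge t)
    (hbt : TBounded C t) (τ : TruncData C t) (Y : C) (m : ℤ) :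
    Y ∈ shiftedClass C le m ↔ ∀ j : ℤ, ((τ.H j).obj Y).obj ∈ shiftedClass C le (m + j) := by
  obtain ⟨a, b, k, ha, hb, rfl⟩ := exists_bounds hbt Y
  have key : ∀ j, ((τ.H j).obj Y).obj ∈ shiftedClass C le (m + j) ↔
      (((τ.H j).obj Y).obj)⟦-j⟧ ∈ shiftedClass C le m := fun j =>
    (shifted_shift_iff hw.iso_le _ (-j) m (m+j) (by lia)).symm
  simp only [key]
  refine ⟨fun h j => homology_le hw htr (fun j Y => ⟨_, τ.isH j Y⟩) m k Y b hb ha h j _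
    (τ.isH j Y), fun h => mem_of_homology (hw.le_ext m) (fun _ => hw.zero_le' m) k Y b hb ha ?_⟩
  intro j D hD
  obtain ⟨e⟩ := (τ.isH j Y).unique hD
  exact hw.iso_le.shifted m e (h j)

lemma ge_iff_homology (hw : IsWeightStructure C le ge) (htr : Transversal C le ge t)
    (hbt : TBounded C t) (τ : TruncData C t) (Y : C) (m : ℤ) :
    Y ∈ shiftedClass C ge m ↔ ∀ j : ℤ, ((τ.H j).obj Y).obj ∈ shiftedClass C ge (m + j) := by
  obtain ⟨a, b, k, ha, hb, hab⟩ := exists_bounds hbt Y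
  have key : ∀ j, ((τ.H j).obj Y).obj ∈ shiftedClass C ge (m + j) ↔
      (((τ.H j).obj Y).obj)⟦-j⟧ ∈ shiftedClass C ge m := fun j =>
    (shifted_shift_iff hw.iso_ge _ (-j) m (m+j) (by lia)).symm
  simp only [key]
  refine ⟨fun h j => homology_ge hw htr m k Y a ha (by convert hb using 1; lia) h j _
    (τ.isH j Y), fun h => mem_of_homology (hw.ge_ext m) (fun _ => hw.zero_ge' m) k Y b hb
      (by rwa [← hab]) ?_⟩
  intro j D hD
  obtain ⟨e⟩ := (τ.isH j Y).unique hD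
  exact hw.iso_ge.shifted m e (h j)

end Main

section Heart

variable {le ge : Set C} {t : TStructure C}

/-- A monomorphism in the heart and its cokernel fit into a distinguished triangle. -/
lemma heart_triangle {A X : THeart C t} (f : A ⟶ X) [Mono f] [HasCokernel f] :
    ∃ (g : X.obj ⟶ (cokernel f).obj) (d : (cokernel f).obj ⟶ A.obj⟦(1 : ℤ)⟧),
      Triangle.mk f.hom g d ∈ distTriang C := by
  obtain ⟨Z, g, d, hT⟩ := distinguished_cocone_triangle f.hom
  have hA1 : t.le (-1) (A.obj⟦(1 : ℤ)⟧) := t.le_shift 0 1 (-1) (by lia) _ A.property.1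
  have hZ0 : t.le 0 Z := (t.isLE₂ _ (rot_of_distTriang _ hT) 0 ⟨X.property.1⟩
    ⟨t.le_monotone (by lia) _ hA1⟩).le
  have hZ1 : t.ge 0 Z := by
    refine ((t.isGE_iff_orthogonal (-1) 0 (by lia) Z).2 fun V x hV => ?_).ge
    have hV := hV.le
    have hxd : x ≫ d = 0 := by
      let e := shiftNegShift V (1 : ℤ)
      have hV1 : t.le 0 (V⟦(-1 : ℤ)⟧) := t.le_shift (-1) (-1) 0 (by lia) _ hV
      obtain ⟨y, hy⟩ := (shiftFunctor C (1 : ℤ)).map_surjective (e.hom ≫ x ≫ d)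
      have hyf : y ≫ f.hom = 0 := by
        apply (shiftFunctor C (1 : ℤ)).map_injective
        have : d ≫ f.hom⟦(1:ℤ)⟧' = 0 := comp_distTriang_mor_zero₃₁ _ hT
        rw [Functor.map_comp, hy, Functor.map_zero]
        simp only [Category.assoc, this, comp_zero]
      obtain ⟨K, N, hK, hN, i, p, d', hT'⟩ := t.exists_triangle (V⟦(-1 : ℤ)⟧) (-1) 0 (by lia)
      have hp : IsTrGE t 0 p := isTrGE_of_triangle hT' hK hN
      have hN0 : t.le 0 N := (t.isLE₂ _ (rot_of_distTriang _ hT') 0 ⟨hV1⟩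
        ⟨t.le_monotone (by lia) _ (t.le_shift (-1) 1 (-2) (by lia) _ hK)⟩).le
      obtain ⟨y', rfl⟩ := hp.surj A.property.2 y
      have h1 : y' ≫ f.hom = 0 := hp.inj X.property.2 _ (by rw [← Category.assoc]; exact hyf)
      let N' : THeart C t := ⟨N, hN0, hN⟩
      let y'' : N' ⟶ A := ObjectProperty.homMk y'
      have h2 : y'' = 0 := by
        rw [← cancel_mono f, zero_comp]
        exact ObjectProperty.hom_ext _ h1
      have h3 : y' = 0 := congrArg (fun z : N' ⟶ A => z.hom) h2
      rw [← cancel_epi e.hom, ← hy, h3, comp_zero, comp_zero, Functor.map_zero]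
    obtain ⟨z, rfl⟩ := coy3 hT x hxd
    rw [tzero z (by lia : (-1 : ℤ) < 0) hV X.property.2, zero_comp]
  let Z' : THeart C t := ⟨Z, hZ0, hZ1⟩
  let g' : X ⟶ Z' := ObjectProperty.homMk g
  have hfg : f ≫ g' = 0 := ObjectProperty.hom_ext _ (comp_distTriang_mor_zero₁₂ _ hT)
  have hginj : ∀ {N : THeart C t} (r : Z' ⟶ N), g' ≫ r = 0 → r = 0 := by
    intro N r hr
    have hr' : g ≫ r.hom = 0 := congrArg (fun z : X ⟶ N => z.hom) hr
    obtain ⟨s, hs⟩ := yon3 hT r.hom hr'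
    apply ObjectProperty.hom_ext
    rw [hs, tzero s (by lia : (-1 : ℤ) < 0) hA1 N.property.2, comp_zero]
    rfl
  obtain ⟨s, hs⟩ := yon2 hT (cokernel.π f).hom
    (congrArg (fun z : A ⟶ cokernel f => z.hom) (cokernel.condition f))
  let s' : Z' ⟶ cokernel f := ObjectProperty.homMk s
  have hs' : g' ≫ s' = cokernel.π f := ObjectProperty.hom_ext _ hs.symm
  let e : Z' ≅ cokernel f :=
    { hom := s'
      inv := cokernel.desc f g' hfg
      hom_inv_id := sub_eq_zero.1 (hginj _ (by
        rw [Preadditive.comp_sub, ← Category.assoc, hs', cokernel.π_desc, Category.comp_id,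
          sub_self]))
      inv_hom_id := by
        rw [← cancel_epi (cokernel.π f), ← Category.assoc, cokernel.π_desc, hs', Category.comp_id] }
  let e0 : Z ≅ (cokernel f).obj := (heartIncl C t).mapIso e
  refine ⟨g ≫ e0.hom, e0.inv ≫ d, isomorphic_distinguished _ hT _ ?_⟩
  refine Triangle.isoMk _ _ (Iso.refl _) (Iso.refl _) e0.symm ?_ ?_ ?_
  · change f.hom ≫ 𝟙 X.obj = 𝟙 A.obj ≫ f.hom
    rw [Category.comp_id, Category.id_comp]
  · change (g ≫ e0.hom) ≫ e0.inv = 𝟙 X.obj ≫ g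
    rw [Category.assoc, e0.hom_inv_id, Category.comp_id, Category.id_comp]
  · change (e0.inv ≫ d) ≫ (𝟙 A.obj)⟦(1 : ℤ)⟧' = e0.inv ≫ d
    rw [CategoryTheory.Functor.map_id, Category.comp_id]

lemma isIso_of_cokernel {A X : THeart C t} (f : A ⟶ X) [Mono f] [HasCokernel f]
    (h : IsZero (cokernel f)) : IsIso f := by
  obtain ⟨g, d, hT⟩ := heart_triangle f
  have h0 : IsZero (cokernel f).obj := by
    rw [IsZero.iff_id_eq_zero] at h ⊢
    exact congrArg (fun z : cokernel f ⟶ cokernel f => z.hom) h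
  have : IsIso f.hom := (Triangle.isZero₃_iff_isIso₁ _ hT).1 h0
  have : IsIso ((heartIncl C t).map f) := this
  exact isIso_of_reflects_iso f (heartIncl C t)

end Heart

section Filtration

variable {le ge : Set C} {t : TStructure C} [HasCokernels (THeart C t)]
    {W : ℤ → (THeart C t ⥤ THeart C t)} {ι : ∀ m : ℤ, W m ⟶ 𝟭 (THeart C t)}
    {σ : ∀ m : ℤ, W (m - 1) ⟶ W m}

lemma heart_isZero_obj {X : THeart C t} (h : IsZero X) : IsZero X.obj := by
  rw [IsZero.iff_id_eq_zero] at h ⊢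
  exact congrArg (fun z : X ⟶ X => z.hom) h

lemma heart_obj_iso {X Y : THeart C t} (f : X ⟶ Y) [IsIso f] : Nonempty (X.obj ≅ Y.obj) :=
  ⟨(heartIncl C t).mapIso (asIso f)⟩

lemma sigma_mono (hmono : ∀ (m : ℤ) (X : THeart C t), Mono ((ι m).app X))
    (hcompat : ∀ (m : ℤ) (X : THeart C t),
      (σ m).app X ≫ (ι m).app X = (ι (m - 1)).app X)
    (m : ℤ) (X : THeart C t) : Mono ((σ m).app X) := by
  have := hmono (m - 1) X
  rw [← hcompat] at this
  exact mono_of_mono _ ((ι m).app X)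

lemma W_le (hw : IsWeightStructure C le ge)
    (hs : ∀ (m : ℤ) (X : THeart C t), Mono ((σ m).app X))
    (hbot : ∀ X : THeart C t, ∃ a : ℤ, ∀ m ≤ a, IsZero ((W m).obj X))
    (hgraded : ∀ (m : ℤ) (X : THeart C t),
      (cokernel ((σ m).app X)).obj ∈ wEq C le ge m) (X : THeart C t) (m : ℤ) :
    ((W m).obj X).obj ∈ shiftedClass C le m := by
  obtain ⟨a, ha⟩ := hbot X
  have key : ∀ (k : ℕ) (m : ℤ), m ≤ a + k → ((W m).obj X).obj ∈ shiftedClass C le m := by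
    intro k
    induction k with
    | zero =>
      intro m hm
      exact hw.zero_le' m (heart_isZero_obj (ha m (by simpa using hm)))
    | succ k ih =>
      intro m hm
      have := hs m X
      obtain ⟨g, d, hT⟩ := heart_triangle ((σ m).app X)
      refine hw.le_ext m _ hT ?_ (hgraded m X).1
      exact hw.le_mono (by lia) (ih (m - 1) (by push_cast at hm; lia))
  exact key (m - a).toNat m (by lia)

lemma le_iff_isIso (hw : IsWeightStructure C le ge)
    (hs : ∀ (m : ℤ) (X : THeart C t), Mono ((σ m).app X))
    (hcompat : ∀ (m : ℤ) (X : THeart C t),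
      (σ m).app X ≫ (ι m).app X = (ι (m - 1)).app X)
    (hbot : ∀ X : THeart C t, ∃ a : ℤ, ∀ m ≤ a, IsZero ((W m).obj X))
    (htop : ∀ X : THeart C t, ∃ b : ℤ, ∀ m : ℤ, b ≤ m → IsIso ((ι m).app X))
    (hgraded : ∀ (m : ℤ) (X : THeart C t),
      (cokernel ((σ m).app X)).obj ∈ wEq C le ge m) (X : THeart C t) (n : ℤ) :
    X.obj ∈ shiftedClass C le n ↔ IsIso ((ι n).app X) := by
  constructor
  · intro hX
    obtain ⟨b, hb⟩ := htop X
    have key : ∀ (k : ℕ) (m : ℤ), b - k ≤ m → n ≤ m → IsIso ((ι m).app X) := by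
      intro k
      induction k with
      | zero =>
        intro m hm _
        exact hb m (by simpa using hm)
      | succ k ih =>
        intro m hm hn
        obtain ⟨p, rfl⟩ : ∃ p, m = p - 1 := ⟨m + 1, by lia⟩
        have h1 : IsIso ((ι p).app X) := ih p (by push_cast at hm; lia) (by lia)
        obtain ⟨e⟩ := heart_obj_iso ((ι p).app X)
        have hWp : ((W p).obj X).obj ∈ shiftedClass C le n := hw.iso_le.shifted n e.symm hX
        have hm1 := hs p X
        have hz : cokernel.π ((σ p).app X) = 0 :=
          ObjectProperty.hom_ext _ (hw.orth (by lia : n < p) hWp (hgraded p X).2 _)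
        have hc : IsZero (cokernel ((σ p).app X)) := by
          rw [IsZero.iff_id_eq_zero, ← cancel_epi (cokernel.π ((σ p).app X)), hz, zero_comp,
            zero_comp]
        have h2 := isIso_of_cokernel _ hc
        rw [← hcompat]
        exact IsIso.comp_isIso
    exact key (b - n).toNat n (by lia) le_rfl
  · intro h
    obtain ⟨e⟩ := heart_obj_iso ((ι n).app X)
    exact hw.iso_le.shifted n e (W_le hw hs hbot hgraded X n)

lemma ge_iff_isZero (hw : IsWeightStructure C le ge)
    (hmono : ∀ (m : ℤ) (X : THeart C t), Mono ((ι m).app X))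
    (hs : ∀ (m : ℤ) (X : THeart C t), Mono ((σ m).app X))
    (hbot : ∀ X : THeart C t, ∃ a : ℤ, ∀ m ≤ a, IsZero ((W m).obj X))
    (htop : ∀ X : THeart C t, ∃ b : ℤ, ∀ m : ℤ, b ≤ m → IsIso ((ι m).app X))
    (hgraded : ∀ (m : ℤ) (X : THeart C t),
      (cokernel ((σ m).app X)).obj ∈ wEq C le ge m) (X : THeart C t) (n : ℤ) :
    X.obj ∈ shiftedClass C ge n ↔ IsZero ((W (n - 1)).obj X) := by
  constructor
  · intro hX
    have hm1 := hmono (n - 1) X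
    have hz : (ι (n - 1)).app X = 0 :=
      ObjectProperty.hom_ext _
        (hw.orth (by lia : n - 1 < n) (W_le hw hs hbot hgraded X (n - 1)) hX _)
    rw [IsZero.iff_id_eq_zero, ← cancel_mono ((ι (n - 1)).app X), hz, comp_zero, comp_zero]
  · intro h
    have key : ∀ (k : ℕ) (m : ℤ), m = n - 1 + k →
        ((W m).obj X).obj ∈ shiftedClass C ge n := by
      intro k
      induction k with
      | zero =>
        intro m hm
        obtain rfl : m = n - 1 := by simpa using hm
        exact hw.zero_ge' n (heart_isZero_obj h)
      | succ k ih =>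
        intro m hm
        have := hs m X
        obtain ⟨g, d, hT⟩ := heart_triangle ((σ m).app X)
        push_cast at hm
        exact hw.ge_ext n _ hT (ih (m - 1) (by lia)) (hw.ge_anti (by lia) (hgraded m X).2)
    obtain ⟨b, hb⟩ := htop X
    have h1 := hb (n - 1 + (b - (n - 1)).toNat) (by lia)
    obtain ⟨e⟩ := heart_obj_iso ((ι (n - 1 + (b - (n - 1)).toNat)).app X)
    exact hw.iso_ge.shifted n e (key _ _ rfl)

end Filtration

end Aux

variable (C)
/-- Let bounded `t` be transversal to bounded `w` and let
`W_{≤m}` (with the inclusions `ι` and transition maps `σ`) be the weight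
filtration functors on the heart, i.e. the unique functorial increasing
exhaustive and separated filtration by subobjects whose `m`-th graded factor
lies in `A_m = C^{t=0} ∩ C_{w=m}`. Then `Y ∈ C_{w≤m}` iff
`W_{≤m+j}(H^t_j Y) = H^t_j Y` for all `j`, and `Y ∈ C_{w≥m}` iff
`W_{≤m+j-1}(H^t_j Y) = 0` for all `j`. -/
theorem statement10 (le ge : Set C) (hw : IsWeightStructure C le ge)
    (hbw : WBounded C le ge) (t : TStructure C) (hbt : TBounded C t)
    (htr : Transversal C le ge t) (τ : TruncData C t)
    [HasCokernels (THeart C t)]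
    (W : ℤ → (THeart C t ⥤ THeart C t)) (ι : ∀ m : ℤ, W m ⟶ 𝟭 (THeart C t))
    (σ : ∀ m : ℤ, W (m - 1) ⟶ W m)
    (hmono : ∀ (m : ℤ) (X : THeart C t), Mono ((ι m).app X))
    (hcompat : ∀ (m : ℤ) (X : THeart C t),
      (σ m).app X ≫ (ι m).app X = (ι (m - 1)).app X)
    (hbot : ∀ X : THeart C t, ∃ a : ℤ, ∀ m ≤ a, IsZero ((W m).obj X))
    (htop : ∀ X : THeart C t, ∃ b : ℤ, ∀ m : ℤ, b ≤ m → IsIso ((ι m).app X))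
    (hgraded : ∀ (m : ℤ) (X : THeart C t),
      (cokernel ((σ m).app X)).obj ∈ wEq C le ge m) :
    ∀ (Y : C) (m : ℤ),
      (Y ∈ shiftedClass C le m ↔
        ∀ j : ℤ, IsIso ((ι (m + j)).app ((τ.H j).obj Y))) ∧
      (Y ∈ shiftedClass C ge m ↔
        ∀ j : ℤ, IsZero ((W (m + j - 1)).obj ((τ.H j).obj Y))) := by
  intro Y m
  have hs := sigma_mono hmono hcompat
  constructor
  · rw [le_iff_homology hw htr hbt τ Y m]
    exact forall_congr' fun j => le_iff_isIso hw hs hcompat hbot htop hgraded _ _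
  · rw [ge_iff_homology hw htr hbt τ Y m]
    exact forall_congr' fun j => ge_iff_isZero hw hmono hs hbot htop hgraded _ _

end PaperWeights
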